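/- Let A ∈ ℂ^{n×n}, B ∈ ℂ^{n×m}, C ∈ ℂ^{p×n}, and let q = s + p. Let V ∈ ℂ^{n×q} satisfy VᴴV = I_q, let K, H ∈ ℂ^{q×s} satisfy AᴴVK = VH, and let C̃ ∈ ℂ^{q×p} satisfy Cᴴ = VC̃. Let L ∈ ℂ^{q×s} be such that LᴴK is invertible, set π := K(LᴴK)⁻¹Lᴴ. Let Y ∈ ℂ^{s×s} be Hermitian, X := V K Y Kᴴ Vᴴ, S := Kᴴ Vᴴ B Bᴴ V K, and suppose π (H Y Kᴴ + K Y Hᴴ + C̃C̃ᴴ − K Y S Y Kᴴ) πᴴ = 0. Then the rank of the Riccati residual satisfies rank(R(X)) ≤ 2p. -/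

import Mathlib

open Matrix

/-- The Riccati residual `R(X) = AᴴX + XA + CᴴC − XBBᴴX`. -/
noncomputable def riccatiResidual {n m p : ℕ} (A : Matrix (Fin n) (Fin n) ℂ)
    (B : Matrix (Fin n) (Fin m) ℂ) (C : Matrix (Fin p) (Fin n) ℂ)
    (X : Matrix (Fin n) (Fin n) ℂ) : Matrix (Fin n) (Fin n) ℂ :=
  Aᴴ * X + X * A + Cᴴ * C - X * B * Bᴴ * X

/-- Subadditivity of rank. -/
theorem matrix_rank_add_le {k : ℕ} (P Q : Matrix (Fin k) (Fin k) ℂ) :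
    (P + Q).rank ≤ P.rank + Q.rank := by
  unfold Matrix.rank
  rw [Matrix.mulVecLin_add]
  refine le_trans (Submodule.finrank_mono ?_) (Submodule.finrank_add_le_finrank_add_finrank _ _)
  rintro _ ⟨x, rfl⟩
  exact Submodule.add_mem_sup ⟨x, rfl⟩ ⟨x, rfl⟩

/-- the Riccati residual of the projected approximate solution
has rank at most `2p`. -/
theorem stmt_8 {n m p s : ℕ}
    (A : Matrix (Fin n) (Fin n) ℂ) (B : Matrix (Fin n) (Fin m) ℂ)
    (C : Matrix (Fin p) (Fin n) ℂ)
    (V : Matrix (Fin n) (Fin (s + p)) ℂ) (hV : Vᴴ * V = 1)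
    (K H : Matrix (Fin (s + p)) (Fin s) ℂ) (hKH : Aᴴ * V * K = V * H)
    (Ct : Matrix (Fin (s + p)) (Fin p) ℂ) (hCt : Cᴴ = V * Ct)
    (L : Matrix (Fin (s + p)) (Fin s) ℂ) (hLK : IsUnit (Lᴴ * K))
    (pr : Matrix (Fin (s + p)) (Fin (s + p)) ℂ)
    (hpr : pr = K * (Lᴴ * K)⁻¹ * Lᴴ)
    (Y : Matrix (Fin s) (Fin s) ℂ) (hY : Yᴴ = Y)
    (X : Matrix (Fin n) (Fin n) ℂ) (hX : X = V * K * Y * Kᴴ * Vᴴ)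
    (S : Matrix (Fin s) (Fin s) ℂ) (hS : S = Kᴴ * Vᴴ * B * Bᴴ * V * K)
    (hproj : pr * (H * Y * Kᴴ + K * Y * Hᴴ + Ct * Ctᴴ - K * Y * S * Y * Kᴴ)
        * prᴴ = 0) :
    (riccatiResidual A B C X).rank ≤ 2 * p := by
  have hdet : IsUnit (Lᴴ * K).det := (Matrix.isUnit_iff_isUnit_det _).mp hLK
  have hprK : (1 - pr) * K = 0 := by
    rw [Matrix.sub_mul, hpr, Matrix.mul_assoc, Matrix.mul_assoc,
      Matrix.nonsing_inv_mul _ hdet, Matrix.one_mul, Matrix.mul_one, sub_self]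
  have hK : s ≤ K.rank := by
    have h1 := Matrix.rank_of_isUnit _ hLK
    have h2 := Matrix.rank_mul_le_right Lᴴ K
    simp at h1
    omega
  have hr : (1 - pr).rank ≤ p := by
    have h := Matrix.rank_add_rank_le_card_of_mul_eq_zero hprK
    simp at h
    omega
  obtain ⟨M, hM⟩ : ∃ M, M = H * Y * Kᴴ + K * Y * Hᴴ + Ct * Ctᴴ - K * Y * S * Y * Kᴴ := ⟨_, rfl⟩
  rw [← hM] at hproj
  have hKH' : Kᴴ * (Vᴴ * A) = Hᴴ * Vᴴ := by
    have := congrArg conjTranspose hKH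
    simpa [Matrix.conjTranspose_mul, Matrix.mul_assoc] using this
  have hC : C = Ctᴴ * Vᴴ := by
    have := congrArg conjTranspose hCt
    simpa [Matrix.conjTranspose_mul] using this
  have h1 : Aᴴ * X = V * (H * Y * Kᴴ) * Vᴴ := by
    rw [hX]
    calc _ = (Aᴴ * V * K) * Y * Kᴴ * Vᴴ := by simp only [Matrix.mul_assoc]
      _ = _ := by rw [hKH]; simp only [Matrix.mul_assoc]
  have h2 : X * A = V * (K * Y * Hᴴ) * Vᴴ := by
    rw [hX]
    simp only [Matrix.mul_assoc]
    rw [hKH']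
  have h3 : Cᴴ * C = V * (Ct * Ctᴴ) * Vᴴ := by
    rw [hCt, hC]
    simp only [Matrix.mul_assoc]
  have h4 : X * B * Bᴴ * X = V * (K * Y * S * Y * Kᴴ) * Vᴴ := by
    rw [hX, hS]
    simp only [Matrix.mul_assoc]
  have hR : riccatiResidual A B C X = V * M * Vᴴ := by
    rw [riccatiResidual, h1, h2, h3, h4, hM]
    simp only [Matrix.mul_sub, Matrix.sub_mul, Matrix.mul_add, Matrix.add_mul]
  have hMd : M = (1 - pr) * M + pr * M * (1 - pr)ᴴ := by
    rw [Matrix.conjTranspose_sub, Matrix.conjTranspose_one, Matrix.mul_sub, hproj,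
      Matrix.sub_mul, Matrix.one_mul, Matrix.mul_one]
    abel
  have hrM : M.rank ≤ 2 * p := by
    rw [hMd]
    have e1 := matrix_rank_add_le ((1 - pr) * M) (pr * M * (1 - pr)ᴴ)
    have e2 := Matrix.rank_mul_le_left (1 - pr) M
    have e3 := Matrix.rank_mul_le_right (pr * M) (1 - pr)ᴴ
    open scoped ComplexOrder in rw [Matrix.rank_conjTranspose] at e3
    omega
  rw [hR]
  exact ((Matrix.rank_mul_le_left _ _).trans (Matrix.rank_mul_le_right _ _)).trans hrM
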